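/- Let r be a normal round representation on ZMod n with 𝒢(r) connected, suppose 𝒢(r) has at most u universal points, and let W be a point. Then the cardinality of the cyclic range [F_l (N_l W), F_l W) is at most n + u − d, where d is the degree of W in 𝒢(r). -/

import Mathlib

open Classical

noncomputable section

def IsRoundRep (n : ℕ) (r : ZMod n → ℕ) : Prop :=
  (∀ i, r i < n) ∧ (∀ i, r i ≤ r (i + 1) + 1)

def Arrow {n : ℕ} (r : ZMod n → ℕ) (i j : ZMod n) : Prop :=
  ∃ k : ℕ, 1 ≤ k ∧ k ≤ r i ∧ j = i + (k : ZMod n)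

def Fr {n : ℕ} (r : ZMod n → ℕ) (i : ZMod n) : ZMod n := i + (r i : ZMod n)

def Fl {n : ℕ} (r : ZMod n → ℕ) (i : ZMod n) : ZMod n :=
  i - (({j : ZMod n | Arrow r j i}).ncard : ZMod n)

def Nr {n : ℕ} (r : ZMod n → ℕ) (i : ZMod n) : ZMod n :=
  if Arrow r i (i + 1) then i + 1 else i

def Nl {n : ℕ} (r : ZMod n → ℕ) (i : ZMod n) : ZMod n :=
  if Arrow r (i - 1) i then i - 1 else i

def Ur {n : ℕ} (r : ZMod n → ℕ) (i : ZMod n) : ZMod n := Fr r i + 1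

def Ul {n : ℕ} (r : ZMod n → ℕ) (i : ZMod n) : ZMod n := Fl r i - 1

def IsNormal {n : ℕ} (r : ZMod n → ℕ) : Prop :=
  ∀ i j : ZMod n, i ≠ j → ¬(Arrow r i j ∧ Arrow r j i)

def roundGraph {n : ℕ} (r : ZMod n → ℕ) : SimpleGraph (ZMod n) :=
  SimpleGraph.fromRel (Arrow r)

def IsStraight {n : ℕ} (r : ZMod n → ℕ) : Prop := ∃ i, r i = 0

def cyclicRange {n : ℕ} (a b : ZMod n) : Set (ZMod n) :=
  {x | ∃ k : ℕ, k ≤ (b - a).val ∧ x = a + (k : ZMod n)}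

def cyclicRangeCO {n : ℕ} (a b : ZMod n) : Set (ZMod n) := cyclicRange a b \ {b}

def cyclicRangeOC {n : ℕ} (a b : ZMod n) : Set (ZMod n) := cyclicRange a b \ {a}

def cyclicRangeOO {n : ℕ} (a b : ZMod n) : Set (ZMod n) := cyclicRange a b \ {a, b}

def coNbhd {V : Type*} (G : SimpleGraph V) (v : V) : Set V :=
  {w | w ≠ v ∧ ¬ G.Adj v w}

def coNbhdSet {V : Type*} (G : SimpleGraph V) (S : Set V) : Set V :=
  ⋃ v ∈ S, coNbhd G v

def IsBipartite {V : Type*} (G : SimpleGraph V) : Prop :=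
  ∃ S : Set V, ∀ v w, G.Adj v w → (v ∈ S ↔ w ∉ S)

def IsUniversalPt {n : ℕ} (r : ZMod n → ℕ) (i : ZMod n) : Prop :=
  ∀ j, j ≠ i → (roundGraph r).Adj i j

def Compressed {n : ℕ} (r : ZMod n → ℕ) : Prop :=
  ∀ i j : ZMod n, Fl r i = Fl r j → Fr r i = Fr r j → i = j

def IsRoundRepOf {V : Type*} (G : SimpleGraph V) (n : ℕ) (r : ZMod n → ℕ)
    (β : V → ZMod n) : Prop :=
  IsRoundRep n r ∧ IsNormal r ∧ Function.Surjective β ∧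
    ∀ u v : V, u ≠ v → (G.Adj u v ↔ (β u = β v ∨ (roundGraph r).Adj (β u) (β v)))

def IsPCA {V : Type*} (G : SimpleGraph V) : Prop :=
  ∃ n : ℕ, 1 ≤ n ∧ ∃ (r : ZMod n → ℕ) (β : V → ZMod n), IsRoundRepOf G n r β

def IsPIG {V : Type*} (G : SimpleGraph V) : Prop :=
  ∃ n : ℕ, 1 ≤ n ∧ ∃ (r : ZMod n → ℕ) (β : V → ZMod n),
    IsRoundRepOf G n r β ∧ IsStraight r

def IsBlockContigOf {V : Type*} (G : SimpleGraph V) (n : ℕ) (r : ZMod n → ℕ)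
    (β : V → ZMod n) : Prop :=
  IsRoundRepOf G n r β ∧ Compressed r ∧
    {i : ZMod n | IsUniversalPt r i}.Subsingleton ∧ (roundGraph r).Connected

def Disconnectable {n : ℕ} (r : ZMod n → ℕ) (a b : ZMod n) : Prop :=
  b = Fr r a ∧ a = Fl r b

def Connectable {n : ℕ} (r : ZMod n → ℕ) (a b : ZMod n) : Prop :=
  b = Ur r a ∧ a = Ul r b

def addEdge {V : Type*} (G : SimpleGraph V) (v w : V) : SimpleGraph V :=
  G ⊔ SimpleGraph.fromRel (fun x y => x = v ∧ y = w)

def IsCoContigChunk {n : ℕ} (r : ZMod n → ℕ) (S : Set (ZMod n)) : Prop :=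
  (∃ a b : ZMod n, S = cyclicRange a b) ∧
  ∃ X : Set (ZMod n), S ⊆ X ∧
    (∃ C : ((roundGraph r)ᶜ).ConnectedComponent,
      X ∪ coNbhdSet (roundGraph r) X = C.supp) ∧
    X ∩ coNbhdSet (roundGraph r) X = ∅ ∧
    (roundGraph r).IsClique X ∧ (roundGraph r).IsClique (coNbhdSet (roundGraph r) X)

def phi {n : ℕ} (w : ZMod (n + 1)) (k : ZMod n) : ZMod (n + 1) :=
  w + 1 + (k.val : ZMod (n + 1))

def removePt {n : ℕ} (s : ZMod (n + 1) → ℕ) (w : ZMod (n + 1)) (k : ZMod n) : ℕ :=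
  if Arrow s (phi w k) w then s (phi w k) - 1 else s (phi w k)

def Receptive {n : ℕ} (r : ZMod n → ℕ) (Bl Br : ZMod n) : Prop :=
  ∃ (s : ZMod (n + 1) → ℕ) (w : ZMod (n + 1)),
    IsRoundRep (n + 1) s ∧ IsNormal s ∧ (roundGraph s).Connected ∧
    Fl s w ≠ w ∧ Fr s w ≠ w ∧ removePt s w = r ∧
    phi w Bl = Fl s w ∧ phi w Br = Fr s w

def dominoGraph : SimpleGraph (Fin 6) :=
  SimpleGraph.fromRel (fun i j =>
    (i, j) = (0, 1) ∨ (i, j) = (1, 2) ∨ (i, j) = (3, 4) ∨ (i, j) = (4, 5) ∨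
    (i, j) = (0, 3) ∨ (i, j) = (1, 4) ∨ (i, j) = (2, 5))

def pGraph : SimpleGraph (Fin 5) :=
  SimpleGraph.fromRel (fun i j =>
    (i, j) = (0, 1) ∨ (i, j) = (1, 2) ∨ (i, j) = (3, 4) ∨
    (i, j) = (0, 3) ∨ (i, j) = (1, 4))

def AlmostConnectable {V : Type*} {n : ℕ} (r : ZMod n → ℕ) (β : V → ZMod n)
    (a b : ZMod n) : Prop :=
  (∃ v : V, β ⁻¹' {a} = {v}) ∧ (∃ w : V, β ⁻¹' {b} = {w}) ∧
  ∃ (hab : a ≠ b) (C : (((roundGraph r).induce {x : ZMod n | x ≠ b})ᶜ).ConnectedComponent)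
    (D : Set (ZMod n)),
      (⟨a, hab⟩ : {x : ZMod n | x ≠ b}) ∈ C.supp ∧
      D = Subtype.val '' C.supp ∧
      Nonempty ((roundGraph r).induce D ≃g pGraphᶜ) ∧
      Nonempty ((roundGraph r).induce (D ∪ {b}) ≃g dominoGraphᶜ) ∧
      Nonempty ((roundGraph r).induce ((D ∪ {b}) \ {a}) ≃g pGraphᶜ)

theorem IsRoundRep.le_add {n : ℕ} {r : ZMod n → ℕ} (hr : IsRoundRep n r) (i : ZMod n) (j : ℕ) :
    r i ≤ r (i + (j : ZMod n)) + j := by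
  induction j with
  | zero => simp
  | succ j ih =>
    have h := hr.2 (i + (j : ZMod n))
    rw [add_assoc] at h
    push_cast
    omega

theorem IsRoundRep.not_arrow_self {n : ℕ} {r : ZMod n → ℕ} (hr : IsRoundRep n r) (i : ZMod n) :
    ¬ Arrow r i i := by
  rintro ⟨k, hk1, hk, h⟩
  have h0 : (k : ZMod n) = 0 := by simpa using h
  have hle := Nat.le_of_dvd hk1 ((ZMod.natCast_eq_zero_iff k n).1 h0)
  have := hr.1 i
  omega

theorem Arrow.pred {n : ℕ} {r : ZMod n → ℕ} {i j : ZMod n} (h : Arrow r i j) (hne : i ≠ j - 1) :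
    Arrow r i (j - 1) := by
  obtain ⟨k, hk1, hk, rfl⟩ := h
  obtain ⟨l, rfl⟩ := Nat.exists_eq_add_of_le' hk1
  refine ⟨l, ?_, by omega, by push_cast; ring⟩
  rcases Nat.eq_zero_or_pos l with rfl | hl
  · exact absurd (by simp) hne
  · exact hl

theorem isUniversalPt_of_arrow_of_arrow_pred {n : ℕ} [NeZero n] {r : ZMod n → ℕ}
    (hr : IsRoundRep n r) {W X : ZMod n} (h₁ : Arrow r W X) (h₂ : Arrow r X (W - 1)) :
    IsUniversalPt r X := by
  intro Y hY
  rw [roundGraph, SimpleGraph.fromRel_adj]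
  refine ⟨hY.symm, ?_⟩
  obtain ⟨k, hk1, hk, rfl⟩ := h₁
  obtain ⟨l, hl1, hl, hW⟩ := h₂
  obtain ⟨j, hj, rfl⟩ : ∃ j : ℕ, j < n ∧ Y = W + (j : ZMod n) :=
    ⟨(Y - W).val, ZMod.val_lt _, by simp⟩
  have hn : n ≤ k + l + 1 := by
    refine Nat.le_of_dvd (by omega) ((ZMod.natCast_eq_zero_iff _ n).1 ?_)
    push_cast
    linear_combination -hW
  rcases lt_trichotomy j k with hjk | rfl | hjk
  · right
    have := hr.le_add W j
    exact ⟨k - j, by omega, by omega, by push_cast [hjk.le]; ring⟩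
  · exact absurd rfl hY
  · left
    exact ⟨j - k, by omega, by omega, by push_cast [hjk.le]; ring⟩

theorem ncard_cyclicRangeCO_le {n : ℕ} [NeZero n] (a b : ZMod n) :
    (cyclicRangeCO a b).ncard ≤ (b - a).val := by
  have hsub : cyclicRangeCO a b ⊆
      ((Finset.range (b - a).val).image fun k : ℕ => a + (k : ZMod n) : Finset (ZMod n)) := by
    rintro x ⟨⟨k, hk, rfl⟩, hx⟩
    rcases hk.lt_or_eq with hk | rfl
    · exact Finset.mem_coe.2 (Finset.mem_image_of_mem _ (Finset.mem_range.2 hk))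
    · exact absurd (by simp) hx
  calc (cyclicRangeCO a b).ncard
      ≤ _ := Set.ncard_le_ncard hsub (Finset.finite_toSet _)
    _ ≤ (b - a).val := by
      rw [Set.ncard_coe_finset]
      exact Finset.card_image_le.trans (Finset.card_range _).le

theorem ncard_neighborSet_le {n : ℕ} [NeZero n] (r : ZMod n → ℕ) (i : ZMod n) :
    ((roundGraph r).neighborSet i).ncard ≤
      {j | Arrow r j i}.ncard + {j | Arrow r i j}.ncard := by
  refine (Set.ncard_le_ncard ?_ (Set.toFinite _)).trans (Set.ncard_union_le _ _)
  intro j hj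
  rw [SimpleGraph.mem_neighborSet, roundGraph, SimpleGraph.fromRel_adj] at hj
  exact hj.2.symm

theorem ncard_arrow_le_ncard_arrow_pred_add_one {n : ℕ} [NeZero n] (r : ZMod n → ℕ)
    (i : ZMod n) : {j | Arrow r j i}.ncard ≤ {j | Arrow r j (i - 1)}.ncard + 1 := by
  refine (Set.ncard_le_ncard ?_ (Set.toFinite _)).trans (Set.ncard_insert_le (i - 1) _)
  intro j hj
  by_cases h : j = i - 1
  · exact Or.inl h
  · exact Or.inr (Arrow.pred hj h)

theorem ncard_arrow_pred_add_ncard_arrow_le {n : ℕ} [NeZero n] {r : ZMod n → ℕ}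
    (hr : IsRoundRep n r) (hnorm : IsNormal r) {W : ZMod n} (hW : Arrow r (W - 1) W) :
    {j | Arrow r j (W - 1)}.ncard + {j | Arrow r W j}.ncard + 2 ≤
      n + {i | IsUniversalPt r i}.ncard := by
  have hne : W - 1 ≠ W := fun h => hr.not_arrow_self W (by rwa [h] at hW)
  have hback : ¬ Arrow r W (W - 1) := fun h => hnorm _ _ hne ⟨hW, h⟩
  have hunion : {j | Arrow r j (W - 1)} ∪ {j | Arrow r W j} ⊆ ({W - 1, W} : Set (ZMod n))ᶜ := by
    rintro j (hj | hj) (rfl | rfl)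
    · exact hr.not_arrow_self _ hj
    · exact hback hj
    · exact hback hj
    · exact hr.not_arrow_self _ hj
  have hinter : {j | Arrow r j (W - 1)} ∩ {j | Arrow r W j} ⊆ {i | IsUniversalPt r i} :=
    fun j hj => isUniversalPt_of_arrow_of_arrow_pred hr hj.2 hj.1
  have h₁ := Set.ncard_le_ncard hunion (Set.toFinite _)
  have h₂ := Set.ncard_le_ncard hinter (Set.toFinite _)
  have h₃ := Set.ncard_union_add_ncard_inter {j | Arrow r j (W - 1)} {j | Arrow r W j}
  have h₄ := Set.ncard_add_ncard_compl ({W - 1, W} : Set (ZMod n))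
  rw [Set.ncard_pair hne, Nat.card_zmod] at h₄
  omega

theorem stmt6 {n : ℕ} (hn : 1 ≤ n) (r : ZMod n → ℕ)
    (hr : IsRoundRep n r) (hnorm : IsNormal r)
    (hconn : (roundGraph r).Connected)
    (u : ℕ) (hu : {i : ZMod n | IsUniversalPt r i}.ncard ≤ u)
    (W : ZMod n) :
    (cyclicRangeCO (Fl r (Nl r W)) (Fl r W)).ncard ≤
      n + u - ((roundGraph r).neighborSet W).ncard := by
  have : NeZero n := ⟨by omega⟩
  refine (ncard_cyclicRangeCO_le _ _).trans ?_
  by_cases hW : Arrow r (W - 1) W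
  · have h₁ := ncard_arrow_le_ncard_arrow_pred_add_one r W
    have h₂ := ncard_arrow_pred_add_ncard_arrow_le hr hnorm hW
    have h₃ := ncard_neighborSet_le r W
    have hdiff : Fl r W - Fl r (Nl r W) =
        (({j | Arrow r j (W - 1)}.ncard + 1 - {j | Arrow r j W}.ncard : ℕ) : ZMod n) := by
      rw [Nl, if_pos hW, Fl, Fl, Nat.cast_sub h₁]
      push_cast
      ring
    rw [hdiff, ZMod.val_natCast]
    refine (Nat.mod_le _ _).trans ?_
    omega
  · simp [Nl, if_neg hW]
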